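/- Let A be a Jacobi-Jordan algebra over a field K of characteristic different from 2 and 3 with dim A ≤ 4. Then A is associative, and moreover A^3 = 0, i.e. (x·y)·z = 0 for all x, y, z ∈ A. -/

import Mathlib

section JacobiJordan

variable {K A : Type*} [Field K] [AddCommGroup A] [Module K A] {mul : A →ₗ[K] A →ₗ[K] A}

theorem jacobiJordan_sq_mul (comm : ∀ x y : A, mul x y = mul y x)
    (jacobi : ∀ x y z : A, mul x (mul y z) + mul y (mul z x) + mul z (mul x y) = 0) (x z : A) :
    mul (mul x x) z = (-2 : K) • mul x (mul x z) := by
  have h := jacobi x x z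
  rw [comm z x, comm z (mul x x)] at h
  linear_combination (norm := module) h

theorem jacobiJordan_mul_self_sq (h3 : (3 : K) ≠ 0)
    (jacobi : ∀ x y z : A, mul x (mul y z) + mul y (mul z x) + mul z (mul x y) = 0) (x : A) :
    mul x (mul x x) = 0 := by
  have h : (3 : K) • mul x (mul x x) = 0 := by linear_combination (norm := module) jacobi x x x
  exact (smul_eq_zero.mp h).resolve_left h3

/-- Left multiplications in a Jacobi-Jordan algebra are nilpotent of index at most `3`. -/
theorem jacobiJordan_mul_mul_mul (h2 : (2 : K) ≠ 0) (h3 : (3 : K) ≠ 0)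
    (comm : ∀ x y : A, mul x y = mul y x)
    (jacobi : ∀ x y z : A, mul x (mul y z) + mul y (mul z x) + mul z (mul x y) = 0) (x z : A) :
    mul x (mul x (mul x z)) = 0 := by
  have h := jacobi x (mul x x) z
  rw [comm z x, jacobiJordan_mul_self_sq h3 jacobi, map_zero,
    jacobiJordan_sq_mul comm jacobi, jacobiJordan_sq_mul comm jacobi, map_smul] at h
  have h' : ((2 : K) * 2) • mul x (mul x (mul x z)) = 0 := by
    linear_combination (norm := module) -h
  exact (smul_eq_zero.mp h').resolve_left (mul_ne_zero h2 h2)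

theorem jacobiJordan_linearIndependent (h2 : (2 : K) ≠ 0) (h3 : (3 : K) ≠ 0)
    (comm : ∀ x y : A, mul x y = mul y x)
    (jacobi : ∀ x y z : A, mul x (mul y z) + mul y (mul z x) + mul z (mul x y) = 0)
    {x y : A} (hxy : mul (mul x x) y ≠ 0) :
    LinearIndependent K ![x, y, mul x x, mul x y, mul x (mul x y)] := by
  have cube := jacobiJordan_mul_self_sq h3 jacobi x
  have nil := jacobiJordan_mul_mul_mul h2 h3 comm jacobi
  have hw : mul x (mul x y) ≠ 0 := fun h => hxy <| by
    rw [jacobiJordan_sq_mul comm jacobi, h, smul_zero]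
  have key : ∀ a b : K, a • mul x x + b • mul x (mul x y) = 0 → a = 0 ∧ b = 0 := by
    intro a b h
    have ha : a = 0 := by
      by_contra ha
      apply hxy
      have hq : mul y (mul x x) = (-2 : K) • mul x (mul x y) := by
        rw [comm, jacobiJordan_sq_mul comm jacobi]
      -- `L_y` scales the square `x²`, up to the factor `a`, hence kills it by nilpotency.
      have e : ∀ c : A, c = mul x x → b • mul y c = (2 * a) • c := by
        rintro _ rfl
        rw [hq]
        linear_combination (norm := module) (-2 : K) • h
      have e0 := e _ rfl
      have e1 := congrArg (mul y) e0
      have e2 := congrArg (mul y) e1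
      simp only [map_smul, nil, smul_zero] at e1 e2
      have ha2 : 2 * a ≠ 0 := mul_ne_zero h2 ha
      have f2 := (smul_eq_zero.mp e2.symm).resolve_left ha2
      rw [f2, smul_zero] at e1
      rw [comm]
      exact (smul_eq_zero.mp e1.symm).resolve_left ha2
    subst ha
    rw [zero_smul, zero_add] at h
    exact ⟨rfl, (smul_eq_zero.mp h).resolve_right hw⟩
  rw [Fintype.linearIndependent_iff]
  intro g hg
  simp only [Fin.sum_univ_five, Matrix.cons_val] at hg
  have hg1 := congrArg (mul x) hg
  simp only [map_add, map_smul, map_zero, cube, nil, smul_zero, add_zero] at hg1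
  have hg2 := congrArg (mul x) hg1
  simp only [map_add, map_smul, map_zero, cube, nil, smul_zero, add_zero, zero_add] at hg2
  have g1 := (smul_eq_zero.mp hg2).resolve_right hw
  rw [g1, zero_smul, add_zero] at hg1
  obtain ⟨g0, g3⟩ := key _ _ hg1
  rw [g0, g1, g3, zero_smul, zero_smul, zero_smul, add_zero, add_zero, zero_add] at hg
  obtain ⟨g2, g4⟩ := key _ _ hg
  intro i
  fin_cases i <;> assumption

end JacobiJordan


/-- A Jacobi-Jordan algebra of dimension at most `4` over a field of characteristic
different from `2` and `3` is associative, and moreover `A³ = 0`,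
i.e. `(x·y)·z = 0` for all `x, y, z`. -/
theorem jacobiJordan_dim_le_four_associative {K A : Type*} [Field K]
    (h2 : (2 : K) ≠ 0) (h3 : (3 : K) ≠ 0)
    [AddCommGroup A] [Module K A] [FiniteDimensional K A]
    (hdim : Module.finrank K A ≤ 4)
    (mul : A →ₗ[K] A →ₗ[K] A)
    (comm : ∀ x y : A, mul x y = mul y x)
    (jacobi : ∀ x y z : A, mul x (mul y z) + mul y (mul z x) + mul z (mul x y) = 0) :
    (∀ x y z : A, mul (mul x y) z = mul x (mul y z)) ∧
    (∀ x y z : A, mul (mul x y) z = 0) := by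
  have sq : ∀ x y : A, mul (mul x x) y = 0 := by
    intro x y
    by_contra h
    have := (jacobiJordan_linearIndependent h2 h3 comm jacobi h).fintype_card_le_finrank
    rw [Fintype.card_fin] at this
    lia
  have cube : ∀ x y z : A, mul (mul x y) z = 0 := by
    intro x y z
    have h := sq (x + y) z
    simp only [map_add, LinearMap.add_apply, sq, comm y x, zero_add, add_zero] at h
    rw [← two_smul K] at h
    exact (smul_eq_zero.mp h).resolve_left h2
  exact ⟨fun x y z => by rw [cube, comm, cube], cube⟩
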